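/- For every integer d ≥ 4, there exist r = ⌊d/2⌋ + 2 nonzero pairwise non-proportional binary quadratic forms f_1, …, f_r over ℂ and nonzero scalars λ_1, …, λ_r ∈ ℂ such that λ_1 f_1^d + ⋯ + λ_r f_r^d = 0. Hence Φ_2(d) ≤ ⌊d/2⌋ + 2 for d ≥ 4. -/

import Mathlib

open MvPolynomial Finset

/-- An integer polynomial all of whose complex roots are algebraic integers is divisible by its
leading coefficient. -/
lemma leadingCoeff_dvd_coeff_of_isIntegral_roots (p : Polynomial ℤ)
    (h : ∀ a : ℂ, p.aeval a = 0 → IsIntegral ℤ a) (j : ℕ) :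
    p.leadingCoeff ∣ p.coeff j := by
  by_cases hp : p = 0
  · simp [hp]
  have hinj : Function.Injective (algebraMap ℤ ℂ) := (algebraMap ℤ ℂ).injective_int
  set P : Polynomial ℂ := p.map (algebraMap ℤ ℂ) with hP
  have hP0 : P ≠ 0 := (Polynomial.map_ne_zero_iff hinj).2 hp
  have hprod := (IsAlgClosed.splits P).eq_prod_roots
  set Q : Polynomial ℂ := (P.roots.map fun x => Polynomial.X - Polynomial.C x).prod
  have hlift : Q ∈ Polynomial.liftsRing (algebraMap (integralClosure ℤ ℂ) ℂ) := by
    refine Subring.multiset_prod_mem _ _ fun q hq => ?_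
    obtain ⟨a, ha, rfl⟩ := Multiset.mem_map.1 hq
    have hroot : p.aeval a = 0 := by
      have := (Polynomial.mem_roots hP0).1 ha
      rwa [Polynomial.IsRoot.def, hP, Polynomial.eval_map_algebraMap] at this
    refine ⟨Polynomial.X - Polynomial.C ⟨a, h a hroot⟩, ?_⟩
    simp
  obtain ⟨z, hz⟩ := (Polynomial.lifts_iff_coeff_lifts Q).1 hlift j
  have hlead : P.leadingCoeff = (p.leadingCoeff : ℂ) := by
    rw [hP, Polynomial.leadingCoeff_map_of_injective hinj]; simp
  have hcoeff : (p.coeff j : ℂ) = p.leadingCoeff * Q.coeff j := by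
    rw [← hlead, ← Polynomial.coeff_C_mul, ← hprod]
    simp [hP]
  have hl0 : (p.leadingCoeff : ℂ) ≠ 0 := by
    exact_mod_cast Polynomial.leadingCoeff_ne_zero.2 hp
  have hint : IsIntegral ℤ (Q.coeff j) := by rw [← hz]; exact z.2
  have hrat : Q.coeff j = algebraMap ℚ ℂ (p.coeff j / p.leadingCoeff : ℚ) := by
    simp only [eq_ratCast, Rat.cast_div, Rat.cast_intCast]
    rw [hcoeff]; field_simp
  rw [hrat, isIntegral_algebraMap_iff (algebraMap ℚ ℂ).injective,
    IsIntegrallyClosed.isIntegral_iff (R := ℤ)] at hint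
  obtain ⟨y, hy⟩ := hint
  refine ⟨y, ?_⟩
  have hy' : Q.coeff j = (y : ℂ) := by rw [hrat, ← hy]; simp
  rw [hy'] at hcoeff
  exact_mod_cast hcoeff

/-- The power `(1 + a t + t ^ 2) ^ d` as a polynomial in `t`. -/
noncomputable def trinomialPow (d : ℕ) (a : ℂ) : Polynomial ℂ :=
  (1 + Polynomial.C a * Polynomial.X + Polynomial.X ^ 2) ^ d

/-- The coefficient of `t ^ i` in `(1 + a t + t ^ 2) ^ d`, as a polynomial in `a`. -/
noncomputable def trinomialCoeff (d i : ℕ) : Polynomial ℤ :=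
  ∑ j ∈ range (d + 1), Polynomial.monomial j
    (if j ≤ i then d.choose j * ((1 + Polynomial.X ^ 2 : Polynomial ℤ) ^ (d - j)).coeff (i - j)
      else 0)

lemma coeff_trinomialCoeff {d j : ℕ} (i : ℕ) (hj : j ≤ d) :
    (trinomialCoeff d i).coeff j =
      if j ≤ i then d.choose j * ((1 + Polynomial.X ^ 2 : Polynomial ℤ) ^ (d - j)).coeff (i - j)
      else 0 := by
  simp only [trinomialCoeff, Polynomial.finsetSum_coeff, Polynomial.coeff_monomial]
  rw [sum_ite_eq' (range (d + 1)) j, if_pos (by simp; omega)]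

lemma coeff_one_add_X_sq_pow (e k : ℕ) :
    ((1 + Polynomial.X ^ 2 : Polynomial ℤ) ^ e).coeff (k * 2) = e.choose k := by
  have : (1 + Polynomial.X ^ 2 : Polynomial ℤ) ^ e =
      Polynomial.expand ℤ 2 ((1 + Polynomial.X) ^ e) := by simp
  rw [this, Polynomial.coeff_expand_mul (by norm_num), Polynomial.coeff_one_add_X_pow]

lemma coeff_trinomialCoeff_sub {d i k : ℕ} (hi : i ≤ d) (hk : k * 2 ≤ i) :
    (trinomialCoeff d i).coeff (i - k * 2) =
      d.choose (i - k * 2) * (d - (i - k * 2)).choose k := by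
  rw [coeff_trinomialCoeff i (by omega), if_pos (by omega),
    show i - (i - k * 2) = k * 2 by omega, coeff_one_add_X_sq_pow]

lemma coeff_trinomialCoeff_self {d i : ℕ} (hi : i ≤ d) :
    (trinomialCoeff d i).coeff i = d.choose i := by
  simpa using coeff_trinomialCoeff_sub (k := 0) hi (by omega)

lemma natDegree_trinomialCoeff {d i : ℕ} (hi : i ≤ d) :
    (trinomialCoeff d i).natDegree = i := by
  refine Polynomial.natDegree_eq_of_le_of_coeff_ne_zero ?_ ?_
  · refine Polynomial.natDegree_sum_le_of_forall_le _ _ fun j _ => ?_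
    split_ifs with h
    · exact (Polynomial.natDegree_monomial_le _).trans h
    · simp
  · rw [coeff_trinomialCoeff_self hi]
    exact_mod_cast (Nat.choose_pos hi).ne'

lemma leadingCoeff_trinomialCoeff {d i : ℕ} (hi : i ≤ d) :
    (trinomialCoeff d i).leadingCoeff = d.choose i := by
  rw [Polynomial.leadingCoeff, natDegree_trinomialCoeff hi, coeff_trinomialCoeff_self hi]

lemma aeval_trinomialCoeff (d i : ℕ) (a : ℂ) :
    (trinomialCoeff d i).aeval a = (trinomialPow d a).coeff i := by
  have hterm (j : ℕ) : (Polynomial.C a * Polynomial.X) ^ j *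
      (1 + Polynomial.X ^ 2) ^ (d - j) * (d.choose j : Polynomial ℂ) =
      Polynomial.X ^ j * (Polynomial.C (a ^ j * d.choose j) *
        ((1 + Polynomial.X ^ 2 : Polynomial ℤ) ^ (d - j)).map (algebraMap ℤ ℂ)) := by
    simp; ring
  rw [trinomialPow, show (1 + Polynomial.C a * Polynomial.X + Polynomial.X ^ 2 : Polynomial ℂ) =
    Polynomial.C a * Polynomial.X + (1 + Polynomial.X ^ 2) by ring, add_pow]
  simp only [trinomialCoeff, map_sum, Polynomial.finsetSum_coeff, hterm,
    Polynomial.coeff_X_pow_mul', Polynomial.coeff_C_mul, Polynomial.coeff_map,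
    Polynomial.aeval_monomial]
  refine sum_congr rfl fun j _ => ?_
  split_ifs
  · simp; ring
  · simp

lemma exists_trinomial_root_of_not_dvd {d n j : ℕ} (hn : n ≤ d)
    (h : ¬ (d.choose n : ℤ) ∣ (trinomialCoeff d n).coeff j) :
    ∃ a : ℂ, (trinomialPow d a).coeff n = 0 ∧ (trinomialPow d a).coeff d ≠ 0 ∧ a ≠ 0 := by
  by_contra! hcon
  rw [← leadingCoeff_trinomialCoeff hn] at h
  refine h (leadingCoeff_dvd_coeff_of_isIntegral_roots _ (fun a ha => ?_) j)
  by_cases ha0 : a = 0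
  · rw [ha0]; exact isIntegral_zero
  refine ⟨trinomialCoeff d d, ?_, ?_⟩
  · simp [Polynomial.Monic, leadingCoeff_trinomialCoeff le_rfl]
  · rw [aeval_trinomialCoeff] at ha
    rw [← Polynomial.aeval_def, aeval_trinomialCoeff]
    by_contra hd
    exact ha0 (hcon a ha hd)

lemma dvd_mul_pred_of_choose_dvd {d n : ℕ} (hn : 2 ≤ n) (hnd : n ≤ d)
    (h : (d.choose n : ℤ) ∣ (trinomialCoeff d n).coeff (n - 2)) :
    (d - n + 1) ∣ n * (n - 1) := by
  have hc := coeff_trinomialCoeff_sub (k := 1) hnd (by omega)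
  rw [one_mul, Nat.choose_one_right] at hc
  rw [hc] at h
  obtain ⟨q, hq⟩ : d.choose n ∣ d.choose (n - 2) * (d - (n - 2)) := by exact_mod_cast h
  obtain ⟨k, rfl⟩ := Nat.exists_eq_add_of_le' hn
  have h1 := Nat.choose_succ_right_eq d (k + 1)
  have h2 := Nat.choose_succ_right_eq d k
  simp only [Nat.add_sub_cancel] at hq
  refine ⟨q, Nat.eq_of_mul_eq_mul_left (Nat.choose_pos hnd) ?_⟩
  have e : d - (k + 2) + 1 = d - (k + 1) := by omega
  rw [e]
  calc d.choose (k + 2) * ((k + 2) * (k + 2 - 1))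
      = d.choose (k + 1 + 1) * (k + 1 + 1) * (k + 1) := by
        rw [show k + 2 - 1 = k + 1 by omega]; ring
    _ = d.choose (k + 1) * (k + 1) * (d - (k + 1)) := by rw [h1]; ring
    _ = d.choose (k + 2) * q * (d - (k + 1)) := by rw [h2, hq]
    _ = _ := by ring

lemma exceptional_of_dvd {d : ℕ} (hd : 5 ≤ d)
    (h : (d / 2 + 2) ∣ (d - (d / 2 + 1)) * (d - (d / 2 + 1) - 1)) :
    d = 8 ∨ d = 9 ∨ d = 20 := by
  have h12 : (d / 2 + 2) ∣ 12 := by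
    rcases Nat.even_or_odd' d with ⟨k, rfl | rfl⟩
    · obtain ⟨l, rfl⟩ : ∃ l, k = l + 2 := ⟨k - 2, by omega⟩
      rw [show 2 * (l + 2) / 2 + 2 = l + 4 by omega,
        show 2 * (l + 2) - (2 * (l + 2) / 2 + 1) = l + 1 by omega] at h
      rw [show 2 * (l + 2) / 2 + 2 = l + 4 by omega]
      rw [Nat.add_sub_cancel] at h
      zify at h ⊢
      have : (12 : ℤ) = (l + 1) * l - (l + 4) * (l - 3) := by ring
      rw [this]
      exact dvd_sub h (dvd_mul_right _ _)
    · obtain ⟨l, rfl⟩ : ∃ l, k = l + 1 := ⟨k - 1, by omega⟩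
      rw [show (2 * (l + 1) + 1) / 2 + 2 = l + 3 by omega,
        show 2 * (l + 1) + 1 - ((2 * (l + 1) + 1) / 2 + 1) = l + 1 by omega] at h
      rw [show (2 * (l + 1) + 1) / 2 + 2 = l + 3 by omega]
      rw [Nat.add_sub_cancel] at h
      zify at h ⊢
      have : (12 : ℤ) = 2 * ((l + 1) * l) - (l + 3) * (2 * l - 4) := by ring
      rw [this]
      exact dvd_sub (h.mul_left _) (dvd_mul_right _ _)
  have hle := Nat.le_of_dvd (by norm_num) h12
  have : d ≤ 21 := by omega
  interval_cases d <;> revert h h12 <;> decide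

lemma trinomialPow_eight_I :
    (trinomialPow 8 Complex.I).coeff 3 = 0 ∧ (trinomialPow 8 Complex.I).coeff 8 ≠ 0 := by
  have hI : (Polynomial.C Complex.I) ^ 2 = -1 := by simp [← Polynomial.C_pow]
  have h2 : trinomialPow 2 Complex.I = (1 + Polynomial.X ^ 2 + Polynomial.X ^ 4) +
      Polynomial.C Complex.I * (2 * Polynomial.X + 2 * Polynomial.X ^ 3) := by
    rw [trinomialPow]
    linear_combination Polynomial.X ^ 2 * hI
  have h4 : trinomialPow 4 Complex.I = (1 - 2 * Polynomial.X ^ 2 - 5 * Polynomial.X ^ 4 -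
      2 * Polynomial.X ^ 6 + Polynomial.X ^ 8) + Polynomial.C Complex.I *
      (4 * Polynomial.X + 8 * Polynomial.X ^ 3 + 8 * Polynomial.X ^ 5 + 4 * Polynomial.X ^ 7) := by
    rw [show trinomialPow 4 Complex.I = trinomialPow 2 Complex.I ^ 2 by
      simp only [trinomialPow, ← pow_mul], h2]
    linear_combination (2 * Polynomial.X + 2 * Polynomial.X ^ 3) ^ 2 * hI
  have h8 : trinomialPow 8 Complex.I = (1 - 20 * Polynomial.X ^ 2 - 70 * Polynomial.X ^ 4 -
      112 * Polynomial.X ^ 6 - 125 * Polynomial.X ^ 8 - 112 * Polynomial.X ^ 10 -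
      70 * Polynomial.X ^ 12 - 20 * Polynomial.X ^ 14 + Polynomial.X ^ 16) +
      Polynomial.C Complex.I * (8 * Polynomial.X - 56 * Polynomial.X ^ 5 -
      120 * Polynomial.X ^ 7 - 120 * Polynomial.X ^ 9 - 56 * Polynomial.X ^ 11 +
      8 * Polynomial.X ^ 15) := by
    rw [show trinomialPow 8 Complex.I = trinomialPow 4 Complex.I ^ 2 by
      simp only [trinomialPow, ← pow_mul], h4]
    linear_combination (4 * Polynomial.X + 8 * Polynomial.X ^ 3 + 8 * Polynomial.X ^ 5 +
      4 * Polynomial.X ^ 7) ^ 2 * hI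
  rw [h8]
  constructor <;> simp [Polynomial.coeff_one, Polynomial.coeff_X, Polynomial.coeff_X_pow]

lemma exists_trinomial_root {d : ℕ} (hd : 4 ≤ d) :
    ∃ a : ℂ, (trinomialPow d a).coeff (d - (d / 2 + 1)) = 0 ∧
      (trinomialPow d a).coeff d ≠ 0 ∧ (a ≠ 0 ∨ Odd (d / 2 + 1)) := by
  obtain rfl | hd5 := hd.eq_or_lt
  · refine ⟨0, ?_, ?_, Or.inr (by decide)⟩
    all_goals
      rw [show trinomialPow 4 0 = 1 + 4 * Polynomial.X ^ 2 + 6 * Polynomial.X ^ 4 +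
        4 * Polynomial.X ^ 6 + Polynomial.X ^ 8 by simp [trinomialPow]; ring]
      simp [Polynomial.coeff_one, Polynomial.coeff_X_pow]
  by_cases h : (d.choose (d - (d / 2 + 1)) : ℤ) ∣
      (trinomialCoeff d (d - (d / 2 + 1))).coeff (d - (d / 2 + 1) - 2)
  · have hdvd := dvd_mul_pred_of_choose_dvd (by omega) (by omega) h
    rw [show d - (d - (d / 2 + 1)) + 1 = d / 2 + 2 by omega] at hdvd
    obtain rfl | rfl | rfl := exceptional_of_dvd hd5 hdvd
    · exact ⟨Complex.I, trinomialPow_eight_I.1, trinomialPow_eight_I.2, Or.inl Complex.I_ne_zero⟩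
    · obtain ⟨a, h1, h2, h3⟩ := exists_trinomial_root_of_not_dvd (d := 9) (n := 4) (j := 4 - 2 * 2)
        (by norm_num) (by rw [coeff_trinomialCoeff_sub (by norm_num) (by norm_num)]; decide)
      exact ⟨a, h1, h2, Or.inl h3⟩
    · obtain ⟨a, h1, h2, h3⟩ := exists_trinomial_root_of_not_dvd (d := 20) (n := 9) (j := 9 - 2 * 2)
        (by norm_num) (by rw [coeff_trinomialCoeff_sub (by norm_num) (by norm_num)]; norm_num [Nat.choose])
      exact ⟨a, h1, h2, Or.inl h3⟩
  · obtain ⟨a, h1, h2, h3⟩ := exists_trinomial_root_of_not_dvd (by omega) h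
    exact ⟨a, h1, h2, Or.inl h3⟩

lemma natDegree_trinomialPow_le (d : ℕ) (a : ℂ) : (trinomialPow d a).natDegree ≤ 2 * d := by
  rw [trinomialPow]
  compute_degree
  omega

lemma reflect_trinomialPow (d : ℕ) (a : ℂ) :
    (trinomialPow d a).reflect (2 * d) = trinomialPow d a := by
  have hbase : (trinomialPow 1 a).reflect 2 = trinomialPow 1 a := by
    ext n
    rw [Polynomial.coeff_reflect]
    by_cases hn : n ≤ 2
    · rw [Polynomial.revAt_le hn]
      interval_cases n <;>
        simp [trinomialPow, Polynomial.coeff_one, Polynomial.coeff_X, Polynomial.coeff_X_pow]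
    · rw [Polynomial.revAt_eq_self_of_lt (by omega)]
  induction d with
  | zero => simp [trinomialPow]
  | succ d ih =>
    have hmul : trinomialPow (d + 1) a = trinomialPow d a * trinomialPow 1 a := by
      simp [trinomialPow, pow_succ]
    rw [hmul, Nat.mul_succ, Polynomial.reflect_mul _ _ (natDegree_trinomialPow_le d a)
      (natDegree_trinomialPow_le 1 a), ih, hbase]

lemma coeff_trinomialPow_symm (a : ℂ) {d i : ℕ} (hi : i ≤ 2 * d) :
    (trinomialPow d a).coeff (2 * d - i) = (trinomialPow d a).coeff i := by
  conv_rhs => rw [← reflect_trinomialPow, Polynomial.coeff_reflect, Polynomial.revAt_le hi]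

lemma homogeneous_trinomial_pow (d : ℕ) (a z u v : ℂ) :
    (u ^ 2 + a * z * (u * v) + z ^ 2 * v ^ 2) ^ d =
      ∑ i ∈ range (2 * d + 1), (trinomialPow d a).coeff i * z ^ i * (u ^ (2 * d - i) * v ^ i) := by
  by_cases hu : u = 0
  · have hlead : (trinomialPow d a).coeff (2 * d) = 1 := by
      have := coeff_trinomialPow_symm a (Nat.zero_le (2 * d))
      rw [Nat.sub_zero] at this
      rw [this, Polynomial.coeff_zero_eq_eval_zero]
      simp [trinomialPow]
    rw [sum_eq_single (2 * d)]
    · simp [hu, hlead]; ring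
    · intro i hi hne
      have : 2 * d - i ≠ 0 := by simp at hi; omega
      simp [hu, this]
    · simp
  · have heval := Polynomial.eval_eq_sum_range' (p := trinomialPow d a) (n := 2 * d + 1)
      (Nat.lt_succ_of_le (natDegree_trinomialPow_le d a)) (z * v / u)
    have hL : (u ^ 2 + a * z * (u * v) + z ^ 2 * v ^ 2) ^ d =
        u ^ (2 * d) * (trinomialPow d a).eval (z * v / u) := by
      simp only [trinomialPow, Polynomial.eval_pow, Polynomial.eval_add, Polynomial.eval_one,
        Polynomial.eval_mul, Polynomial.eval_C, Polynomial.eval_X, pow_mul, ← mul_pow]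
      congr 1
      field_simp
    rw [hL, heval, mul_sum]
    refine sum_congr rfl fun i hi => ?_
    have hi' : i ≤ 2 * d := by simp at hi; omega
    rw [← Nat.sub_add_cancel hi', pow_add, Nat.sub_add_cancel hi', div_pow, mul_pow]
    field_simp

lemma sum_pow_of_isPrimitiveRoot {z : ℂ} {m : ℕ} (hz : IsPrimitiveRoot z m) (e : ℕ) :
    ∑ j ∈ range m, (z ^ j) ^ e = if m ∣ e then (m : ℂ) else 0 := by
  have hcomm (j : ℕ) : (z ^ j) ^ e = (z ^ e) ^ j := by rw [← pow_mul, ← pow_mul, mul_comm]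
  simp only [hcomm]
  split_ifs with h
  · simp [(hz.pow_eq_one_iff_dvd e).2 h]
  · have hne : 1 - z ^ e ≠ 0 := fun h' =>
      h ((hz.pow_eq_one_iff_dvd e).1 (sub_eq_zero.1 h').symm)
    have := mul_neg_geom_sum (z ^ e) m
    rw [← pow_mul, mul_comm e m, pow_mul, hz.pow_eq_one, one_pow, sub_self] at this
    exact (mul_eq_zero.1 this).resolve_left hne

/-- The averaging of `d`-th powers of trinomials over the `m`-th roots of unity only sees the
middle coefficient. -/
lemma sum_trinomial_pow_eq {z a : ℂ} {d m : ℕ} (hz : IsPrimitiveRoot z m) (hmd : m ≤ d)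
    (hdm : d < 2 * m) (ha : (trinomialPow d a).coeff (d - m) = 0) (u v : ℂ) :
    ∑ j ∈ range m, (z ^ j) ^ (d * (m - 1)) *
        (u ^ 2 + a * z ^ j * (u * v) + (z ^ j) ^ 2 * v ^ 2) ^ d =
      m * (trinomialPow d a).coeff d * (u * v) ^ d := by
  simp only [homogeneous_trinomial_pow, mul_sum]
  rw [sum_comm]
  have hinner (i : ℕ) : ∑ j ∈ range m, (z ^ j) ^ (d * (m - 1)) *
      ((trinomialPow d a).coeff i * (z ^ j) ^ i * (u ^ (2 * d - i) * v ^ i)) =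
      (trinomialPow d a).coeff i * (u ^ (2 * d - i) * v ^ i) *
        if m ∣ d * (m - 1) + i then (m : ℂ) else 0 := by
    rw [← sum_pow_of_isPrimitiveRoot hz, mul_sum]
    exact sum_congr rfl fun j _ => by rw [pow_add]; ring
  simp only [hinner]
  have hdm' : d * (m - 1) + d = m * d := by
    obtain ⟨k, rfl⟩ : ∃ k, m = k + 1 := ⟨m - 1, by omega⟩
    simp; ring
  rw [sum_eq_single d]
  · rw [if_pos ⟨d, hdm'⟩, show 2 * d - d = d by omega, mul_pow]
    ring
  · intro i hi hne
    split_ifs with hdvd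
    · have hi' : i ≤ 2 * d := by simp at hi; omega
      have hcoeff : (trinomialPow d a).coeff i = 0 := by
        obtain hlt | hgt := hne.lt_or_gt
        · have hm : m ∣ d - i := by
            have := Nat.dvd_sub (Dvd.intro d rfl : m ∣ m * d) hdvd
            rwa [show m * d - (d * (m - 1) + i) = d - i by omega] at this
          obtain ⟨k, hk⟩ := hm
          have hk1 : k = 1 := by
            have : k < 2 := by
              by_contra! h
              have : 2 * m ≤ m * k := by nlinarith
              omega
            have : k ≠ 0 := by rintro rfl; omega
            omega
          rw [show i = d - m by subst hk1; omega, ha]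
        · have hm : m ∣ i - d := by
            have := Nat.dvd_sub hdvd (Dvd.intro d rfl : m ∣ m * d)
            rwa [show d * (m - 1) + i - m * d = i - d by omega] at this
          obtain ⟨k, hk⟩ := hm
          have hk1 : k = 1 := by
            have : k < 2 := by
              by_contra! h
              have : 2 * m ≤ m * k := by nlinarith
              omega
            have : k ≠ 0 := by rintro rfl; omega
            omega
          rw [← coeff_trinomialPow_symm a hi',
            show 2 * d - i = d - m by subst hk1; omega, ha]
      simp [hcoeff]
    · simp
  · simp; omega

/-- The binary quadratic form `x ^ 2 + a z x y + z ^ 2 y ^ 2`. -/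
noncomputable def trinomialForm (a z : ℂ) : MvPolynomial (Fin 2) ℂ :=
  X 0 ^ 2 + C (a * z) * (X 0 * X 1) + C (z ^ 2) * X 1 ^ 2

lemma eval_trinomialForm (a z : ℂ) (x : Fin 2 → ℂ) :
    eval x (trinomialForm a z) =
      x 0 ^ 2 + a * z * (x 0 * x 1) + z ^ 2 * x 1 ^ 2 := by
  simp [trinomialForm]

lemma isHomogeneous_X_mul_X : (X 0 * X 1 : MvPolynomial (Fin 2) ℂ).IsHomogeneous 2 :=
  (isHomogeneous_X ℂ 0).mul (isHomogeneous_X ℂ 1)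

lemma isHomogeneous_trinomialForm (a z : ℂ) : (trinomialForm a z).IsHomogeneous 2 :=
  ((isHomogeneous_X_pow 0 2).add (isHomogeneous_X_mul_X.C_mul _)).add
    ((isHomogeneous_X_pow 1 2).C_mul _)

lemma trinomialForm_ne_zero (a z : ℂ) : trinomialForm a z ≠ 0 := fun h => by
  simpa [eval_trinomialForm] using congrArg (eval ![1, 0]) h

lemma trinomialForm_ne_smul_X_mul_X (a z c : ℂ) : trinomialForm a z ≠ c • (X 0 * X 1) :=
  fun h => by simpa [eval_trinomialForm, smul_eval] using congrArg (eval ![1, 0]) h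

lemma X_mul_X_ne_smul_trinomialForm (a z c : ℂ) : X 0 * X 1 ≠ c • trinomialForm a z := by
  intro h
  have hc : c = 0 := by
    simpa [eval_trinomialForm, smul_eval] using (congrArg (eval ![1, 0]) h).symm
  simpa [hc] using congrArg (eval ![1, 1]) h

lemma eq_of_trinomialForm_eq_smul {a z w c : ℂ} (h : trinomialForm a z = c • trinomialForm a w) :
    a * z = a * w ∧ z ^ 2 = w ^ 2 := by
  have h0 := congrArg (eval ![1, 0]) h
  have h1 := congrArg (eval ![1, 1]) h
  have h2 := congrArg (eval ![1, -1]) h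
  simp [eval_trinomialForm, smul_eval] at h0 h1 h2
  rw [← h0] at h1 h2
  constructor
  · linear_combination (h1 - h2) / 2
  · linear_combination (h1 + h2) / 2

lemma trinomialForm_pow_ne_smul {a z : ℂ} {m : ℕ} (hz : IsPrimitiveRoot z m)
    (ha : a ≠ 0 ∨ Odd m) {i j : ℕ} (hi : i < m) (hj : j < m) (hij : i ≠ j) (c : ℂ) :
    trinomialForm a (z ^ i) ≠ c • trinomialForm a (z ^ j) := by
  intro h
  obtain ⟨h1, h2⟩ := eq_of_trinomialForm_eq_smul h
  refine hij (hz.pow_inj hi hj ?_)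
  obtain ha | ⟨k, hk⟩ := ha
  · exact mul_left_cancel₀ ha h1
  · have hroot (l : ℕ) : z ^ l = ((z ^ l) ^ 2) ^ (k + 1) := by
      rw [← pow_mul, show 2 * (k + 1) = m + 1 by omega, pow_succ, ← pow_mul, mul_comm l m,
        pow_mul, hz.pow_eq_one, one_pow, one_mul]
    rw [hroot i, h2, ← hroot j]

/-- For every `d ≥ 4`, with `r = ⌊d/2⌋ + 2` there exist `r` nonzero,
pairwise non-proportional binary quadratic forms over `ℂ` whose `d`-th powers
admit a linear dependence with all coefficients nonzero; hence
`Φ_2(d) ≤ ⌊d/2⌋ + 2` for `d ≥ 4`. -/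
theorem Phi_two_le_half_d_plus_two (d : ℕ) (hd : 4 ≤ d) :
    ∃ (f : Fin (d / 2 + 2) → MvPolynomial (Fin 2) ℂ)
      (lam : Fin (d / 2 + 2) → ℂ),
      (∀ i, (f i).IsHomogeneous 2) ∧ (∀ i, f i ≠ 0) ∧
      (∀ i j, i ≠ j → ∀ c : ℂ, f i ≠ c • f j) ∧
      (∀ i, lam i ≠ 0) ∧ ∑ i, lam i • f i ^ d = 0 := by
  obtain ⟨a, ha, had, hodd⟩ := exists_trinomial_root hd
  obtain ⟨m, hm⟩ : ∃ m, m = d / 2 + 1 := ⟨_, rfl⟩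
  rw [← hm] at ha hodd
  rw [show d / 2 + 2 = m + 1 by omega]
  have hm0 : m ≠ 0 := by omega
  obtain ⟨z, hz⟩ : ∃ z : ℂ, IsPrimitiveRoot z m := ⟨_, Complex.isPrimitiveRoot_exp m hm0⟩
  refine ⟨Fin.snoc (α := fun _ => MvPolynomial (Fin 2) ℂ)
      (fun j : Fin m => trinomialForm a (z ^ (j : ℕ))) (X 0 * X 1),
    Fin.snoc (α := fun _ => ℂ) (fun j : Fin m => (z ^ (j : ℕ)) ^ (d * (m - 1)))
      (-(m * (trinomialPow d a).coeff d)), ?_, ?_, ?_, ?_, ?_⟩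
  · refine Fin.lastCases ?_ fun i => ?_
    · simpa using isHomogeneous_X_mul_X
    · simpa using isHomogeneous_trinomialForm a _
  · refine Fin.lastCases ?_ fun i => ?_
    · simp
    · simpa using trinomialForm_ne_zero a _
  · refine Fin.lastCases (fun j => ?_) fun i j => ?_
    · refine Fin.lastCases (fun h => absurd rfl h) (fun j _ c => ?_) j
      simpa using X_mul_X_ne_smul_trinomialForm a _ c
    · refine Fin.lastCases (fun _ c => ?_) (fun j h c => ?_) j
      · simpa using trinomialForm_ne_smul_X_mul_X a _ c
      · have hij : (i : ℕ) ≠ j := fun h' => h (by rw [Fin.ext h'])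
        simpa using trinomialForm_pow_ne_smul hz hodd i.2 j.2 hij c
  · refine Fin.lastCases ?_ fun i => ?_
    · simpa using ⟨hm0, had⟩
    · simpa using fun h => absurd h (hz.ne_zero hm0)
  · rw [Fin.sum_univ_castSucc]
    simp only [Fin.snoc_castSucc, Fin.snoc_last]
    refine MvPolynomial.funext fun x => ?_
    have hsum := sum_trinomial_pow_eq hz (by omega) (by omega) ha (x 0) (x 1)
    rw [← Fin.sum_univ_eq_sum_range (fun j => (z ^ j) ^ (d * (m - 1)) *
      (x 0 ^ 2 + a * z ^ j * (x 0 * x 1) + (z ^ j) ^ 2 * x 1 ^ 2) ^ d)] at hsum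
    simp only [map_add, map_sum, smul_eval, map_pow, eval_trinomialForm, hsum, map_mul, eval_X,
      map_zero]
    ring
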